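/- Let x_1, …, x_n be points in a metric space, let h > 0, and let Z be a finite set of points such that every x_i lies within distance h/4 of some point of Z (an h/4-cover of {x_1,…,x_n}). For each i let n(x_i, h/2) = #{j ∈ [n] : dist(x_j, x_i) ≤ h/2}. Then Σ_{i=1}^n 1/n(x_i, h/2) ≤ |Z|. -/

import Mathlib

open Finset
open scoped BigOperators Classical

/-- covering bound for the sum of inverse neighbor counts.
If `Z` is an `h/4`-cover of the points `x₁,…,xₙ` and `n(xᵢ, h/2)` is the number of
sample points within distance `h/2` of `xᵢ`, then `Σᵢ 1/n(xᵢ, h/2) ≤ |Z|`. -/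
theorem cover_inverse_count {α : Type*} [MetricSpace α] {n : ℕ}
    (x : Fin n → α) (h : ℝ) (hh : 0 < h)
    (Z : Finset α) (hcover : ∀ i, ∃ z ∈ Z, dist (x i) z ≤ h / 4) :
    ∑ i : Fin n,
        (1 : ℝ) / ((Finset.univ.filter fun j => dist (x j) (x i) ≤ h / 2).card : ℝ) ≤
      (Z.card : ℝ) := by
  choose f hfZ hf using hcover
  rw [← Finset.sum_fiberwise_of_maps_to (s := Finset.univ) (t := Z) (g := f) fun i _ => hfZ i,
    Finset.card_eq_sum_ones, Nat.cast_sum]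
  refine Finset.sum_le_sum fun z _ => ?_
  calc _ ≤ ∑ _i ∈ Finset.univ.filter fun i => f i = z,
        (1 : ℝ) / ((Finset.univ.filter fun i => f i = z).card : ℝ) := by
        refine Finset.sum_le_sum fun i hi => ?_
        have hcard : 0 < (Finset.univ.filter fun i => f i = z).card :=
          Finset.card_pos.mpr ⟨i, hi⟩
        refine one_div_le_one_div_of_le (by exact_mod_cast hcard) ?_
        refine Nat.cast_le.mpr (Finset.card_le_card fun j hj => ?_)
        simp only [Finset.mem_filter, Finset.mem_univ, true_and] at hi hj ⊢
        have hi' := hf i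
        have hj' := hf j
        rw [hi] at hi'
        rw [hj] at hj'
        linarith [dist_triangle_right (x j) (x i) z]
    _ ≤ _ := by
        rw [Finset.sum_const, nsmul_eq_mul, mul_one_div, Nat.cast_one]
        exact div_self_le_one _
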